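/- arXiv:1703.01207 — 6 statements merged into one kernel-verified Lean document; each statement's English description precedes it below -/
import Mathlib

section
/- Let G be a finite simple graph on n vertices with n ≥ 4, and suppose the minimum degree of G is at most 1. Then G does not have a legal system. -/
open SimpleGraph

noncomputable def chi {V : Type*} (A : Set V) : V → ZMod 2 :=
  A.indicator 1

def LegalState {V : Type*} (G : SimpleGraph V) (S : Set V) : Prop :=
  S.Nonempty ∧ Sᶜ.Nonempty ∧ (G.induce S).Connected ∧ (G.induce Sᶜ).Connected

def IsMove {V : Type*} (G : SimpleGraph V) (v : V) (M : Set V) : Prop :=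
  v ∈ M ∧ ∀ u ∈ M, ¬ G.Adj v u

noncomputable def actSet {V : Type*} (f : V → ZMod 2) (S : Set V) : Set V :=
  {x | f x + chi S x = 1}

def IsLegalSystem {V : Type*} (G : SimpleGraph V) (S : Set V) (M : V → Set V) : Prop :=
  (∀ v, IsMove G v (M v)) ∧
    ∀ g ∈ AddSubgroup.closure (Set.range fun v => chi (M v)),
      LegalState G (actSet g S)

def HasLegalSystem {V : Type*} (G : SimpleGraph V) : Prop :=
  ∃ (S : Set V) (M : V → Set V), IsLegalSystem G S M

theorem aux_conn {V : Type*} (G : SimpleGraph V) (T : Set V) (h : (G.induce T).Connected)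
    (x y : V) (hx : x ∈ T) (hy : y ∈ T) (hxy : x ≠ y) : ∃ z, G.Adj x z ∧ z ∈ T := by
  have : Nontrivial T := ⟨⟨x, hx⟩, ⟨y, hy⟩, by simpa using hxy⟩
  obtain ⟨z, hz⟩ := h.preconnected.exists_adj_of_nontrivial ⟨x, hx⟩
  exact ⟨z, by simpa using hz, z.2⟩

theorem z2 (x : ZMod 2) : x = 0 ∨ x = 1 := by
  revert x; decide

theorem z2b (p q : ZMod 2) (h : ¬ q = p + 1) : p = q := by
  revert p q; decide

theorem aux_nb {V : Type*} (G : SimpleGraph V) (S : Set V) (g : V → ZMod 2)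
    (h : LegalState G (actSet g S)) (x y : V) (hxy : x ≠ y)
    (he : g x + chi S x = g y + chi S y) :
    ∃ z, G.Adj x z ∧ g z + chi S z = g x + chi S x := by
  obtain ⟨-, -, h1, h2⟩ := h
  rcases z2 (g x + chi S x) with h0 | h0
  · obtain ⟨z, hz, hz'⟩ := aux_conn G _ h2 x y
      (by simp [actSet, h0]) (by simp [actSet, ← he, h0]) hxy
    refine ⟨z, hz, ?_⟩
    rcases z2 (g z + chi S z) with h3 | h3
    · rw [h3, h0]
    · exact absurd h3 hz'
  · obtain ⟨z, hz, hz'⟩ := aux_conn G _ h1 x y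
      (by simp [actSet, h0]) (by simp [actSet, ← he, h0]) hxy
    exact ⟨z, hz, by rw [h0]; exact hz'⟩

theorem aux_main {V : Type*} [Fintype V] [DecidableEq V]
    (G : SimpleGraph V) (hn : 4 ≤ Fintype.card V)
    (H : AddSubgroup (V → ZMod 2)) (s0 : V → ZMod 2) (c : V → V → ZMod 2)
    (hc : ∀ v, c v ∈ H) (hc1 : ∀ v, c v v = 1) (hc0 : ∀ v u, G.Adj v u → c v u = 0)
    (hL : ∀ g ∈ H, ∀ x y, x ≠ y → g x + s0 x = g y + s0 y →
      ∃ z, G.Adj x z ∧ g z + s0 z = g x + s0 x)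
    (v : V) (w : V) (hv : ∀ u, G.Adj v u → u = w) : False := by
  have big : ∀ a b : V, ∃ x y : V, x ≠ y ∧ x ≠ a ∧ x ≠ b ∧ y ≠ a ∧ y ≠ b := by
    intro a b
    have h1 : 1 < (({a, b} : Finset V)ᶜ).card := by
      rw [Finset.card_compl]
      have := Finset.card_le_two (a := a) (b := b)
      omega
    obtain ⟨x, hx, y, hy, hxy⟩ := Finset.one_lt_card.1 h1
    simp at hx hy
    exact ⟨x, y, hxy, hx.1, hx.2, hy.1, hy.2⟩
  by_cases hvw : G.Adj v w
  · have av := hc1 v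
    have aw := hc0 v w hvw
    have bw := hc1 w
    have bv := hc0 w v hvw.symm
    have odd : ∀ g ∈ H, g v + s0 v ≠ g w + s0 w → ∀ y, y ≠ v →
        g y + s0 y = g v + s0 v + 1 := by
      intro g hg hne y hy
      by_contra hcon
      have e : g v + s0 v = g y + s0 y := z2b _ _ hcon
      obtain ⟨z, hz, hz'⟩ := hL g hg v y hy.symm e
      rw [hv z hz] at hz'
      exact hne hz'.symm
    obtain ⟨t, ht, htne⟩ : ∃ t ∈ H, t v + s0 v ≠ t w + s0 w := by
      by_cases h : s0 v = s0 w
      · exact ⟨c v, hc v, by simp [av, aw, h]⟩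
      · exact ⟨0, H.zero_mem, by simpa using h⟩
    -- even elements are constant
    have even : ∀ g ∈ H, g v = g w → ∀ y, g y = g v := by
      intro g hg he y
      by_cases hy : y = v
      · rw [hy]
      have h1 := odd t ht htne y hy
      have h2 := odd (g + t) (H.add_mem hg ht) (by
        simp only [Pi.add_apply, he, add_assoc]
        simpa using htne) y hy
      simp only [Pi.add_apply] at h2
      have : g y + (t y + s0 y) = g v + (t v + s0 v + 1) := by linear_combination h2
      rw [h1] at this
      exact add_right_cancel this
    have edge : ∀ u u', G.Adj u u' → c v u ≠ c v u' := by
      intro u u' h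
      have h1 := hc1 u
      have h0 := hc0 u u' h
      by_cases he : c u v = c u w
      · have e1 := even _ (hc u) he u
        have e2 := even _ (hc u) he u'
        rw [h1] at e1; rw [h0] at e2
        exact absurd (e1.trans e2.symm) (by decide)
      · have hh : (c u + c v) v = (c u + c v) w := by
          simp only [Pi.add_apply, av, aw]
          generalize c u v = p at *
          generalize c u w = q at *
          revert he; clear * -; revert p q; decide
        have e1 := even _ (H.add_mem (hc u) (hc v)) hh u
        have e2 := even _ (H.add_mem (hc u) (hc v)) hh u'
        have e3 := e1.trans e2.symm
        simp only [Pi.add_apply, h1, h0] at e3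
        intro h4
        rw [h4] at e3
        simp at e3
    have hf : ∀ y, y ≠ v → (t + c v) y + s0 y = t v + s0 v + 1 + c v y := by
      intro y hy
      have := odd t ht htne y hy
      simp only [Pi.add_apply]; linear_combination this
    have hfv : (t + c v) v + s0 v = t v + s0 v + 1 := by
      simp only [Pi.add_apply, av]; ring
    have hfH := H.add_mem ht (hc v)
    have one : ∀ y, y ≠ v → y ≠ w → c v y = 1 := by
      intro y hyv hyw
      rcases z2 (c v y) with h | h
      · obtain ⟨z, hz, hz'⟩ := hL _ hfH y w hyw (by
          rw [hf y hyv, hf w hvw.ne.symm, h, aw])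
        have hzv : z ≠ v := by
          rintro rfl
          exact hyw (hv y hz.symm)
        rw [hf y hyv, hf z hzv] at hz'
        exact absurd (add_left_cancel hz').symm (edge y z hz)
      · exact h
    obtain ⟨x, y, hxy, hxv, hxw, hyv, hyw⟩ := big v w
    obtain ⟨z, hz, hz'⟩ := hL _ hfH x y hxy (by
      rw [hf x hxv, hf y hyv, one x hxv hxw, one y hyv hyw])
    have hzv : z ≠ v := by
      rintro rfl
      exact hxw (hv x hz.symm)
    rw [hf x hxv, hf z hzv] at hz'
    exact absurd (add_left_cancel hz').symm (edge x z hz)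
  · have iso : ∀ u, ¬ G.Adj v u := fun u h => hvw (hv u h ▸ h)
    have odd : ∀ g ∈ H, ∀ y, y ≠ v → g y + s0 y = g v + s0 v + 1 := by
      intro g hg y hy
      by_contra hcon
      have e : g v + s0 v = g y + s0 y := z2b _ _ hcon
      obtain ⟨z, hz, hz'⟩ := hL g hg v y hy.symm e
      exact iso z hz
    have const : ∀ g ∈ H, ∀ y, g y = g v := by
      intro g hg y
      by_cases hy : y = v
      · rw [hy]
      have h1 := odd g hg y hy
      have h2 := odd 0 H.zero_mem y hy
      simp only [Pi.zero_apply] at h2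
      linear_combination h1 - h2
    obtain ⟨x, y, hxy, hxv, -, hyv, -⟩ := big v v
    obtain ⟨z, hz, -⟩ := hL 0 H.zero_mem x y hxy (by
      rw [odd 0 H.zero_mem x hxv, odd 0 H.zero_mem y hyv])
    have e := (const _ (hc x) x).trans (const _ (hc x) z).symm
    rw [hc1, hc0 x z hz] at e
    exact absurd e (by decide)

theorem min_degree_le_one_no_legal_system
    {V : Type*} [Fintype V] [DecidableEq V] [Nonempty V]
    (G : SimpleGraph V) [DecidableRel G.Adj]
    (hn : 4 ≤ Fintype.card V) (hδ : G.minDegree ≤ 1) :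
    ¬ HasLegalSystem G := by
  rintro ⟨S, M, hM, hL⟩
  obtain ⟨v, hv⟩ := G.exists_minimal_degree_vertex
  rw [hv, ← G.card_neighborFinset_eq_degree, Finset.card_le_one_iff_subset_singleton] at hδ
  obtain ⟨w, hw⟩ := hδ
  refine aux_main G hn (AddSubgroup.closure (Set.range fun v => chi (M v))) (chi S) (fun v => chi (M v))
    (fun v => AddSubgroup.subset_closure (Set.mem_range_self v)) ?_ ?_
    (fun g hg => aux_nb G S g (hL g hg)) v w ?_
  · intro v
    simp [chi, (hM v).1]
  · intro v u h
    have : u ∉ M v := fun h' => (hM v).2 u h' h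
    simp [chi, this]
  · intro u hu
    have := hw ((G.mem_neighborFinset v u).2 hu)
    simpa using this
end

section
/- Let G be the 'bowtie' graph with vertex set {v, u₁, u₂, w₁, w₂} and edge set {{v,u₁}, {v,u₂}, {v,w₁}, {v,w₂}, {u₁,u₂}, {w₁,w₂}}. Then G does not have a legal system. -/
open SimpleGraph

/-- The "bowtie" graph on vertices `{v, u₁, u₂, w₁, w₂} = {0, 1, 2, 3, 4}` with edges
`{v,u₁}, {v,u₂}, {v,w₁}, {v,w₂}, {u₁,u₂}, {w₁,w₂}`. -/
def bowtieGraph : SimpleGraph (Fin 5) :=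
  SimpleGraph.fromEdgeSet {s(0, 1), s(0, 2), s(0, 3), s(0, 4), s(1, 2), s(3, 4)}

theorem bt_sep (A : Set (Fin 5)) (hA : (bowtieGraph.induce A).Connected) (a : Fin 5)
    (ha : a = 1 ∨ a = 2) (haA : a ∈ A) (h3 : (3 : Fin 5) ∈ A) : (0 : Fin 5) ∈ A := by
  by_contra h0
  have key : ∀ x y : A, (bowtieGraph.induce A).Walk x y →
      (x.1 = 1 ∨ x.1 = 2) → (y.1 = 1 ∨ y.1 = 2) := by
    intro x y p
    induction p with
    | nil => exact id
    | @cons u v w h p ih =>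
      intro hu
      apply ih
      have hv : v.1 ≠ 0 := fun h => h0 (h ▸ v.2)
      have h' : bowtieGraph.Adj u.1 v.1 := h
      obtain ⟨u, hu'⟩ := u
      obtain ⟨v, hv'⟩ := v
      simp only [bowtieGraph, SimpleGraph.fromEdgeSet_adj, Set.mem_insert_iff,
        Set.mem_singleton_iff] at h' hu hv ⊢
      clear ih h p hu' hv'
      rcases hu with rfl | rfl <;> fin_cases v <;> simp at h' hv ⊢
  obtain ⟨p⟩ := hA.preconnected ⟨a, haA⟩ ⟨3, h3⟩
  have := key _ _ p ha
  simp at this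

theorem bt_legal (T : Set (Fin 5)) (hT : LegalState bowtieGraph T) (a : Fin 5)
    (ha : a = 1 ∨ a = 2) :
    (a ∈ T → (3 : Fin 5) ∈ T → (0 : Fin 5) ∈ T) ∧
    (a ∉ T → (3 : Fin 5) ∉ T → (0 : Fin 5) ∉ T) :=
  ⟨fun h h' => bt_sep T hT.2.2.1 a ha h h', fun h h' => bt_sep Tᶜ hT.2.2.2 a ha h h'⟩

theorem chi_in {V : Type*} {A : Set V} {x : V} (h : x ∈ A) : chi A x = 1 := by
  simp [chi, h]

theorem chi_out {V : Type*} {A : Set V} {x : V} (h : x ∉ A) : chi A x = 0 := by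
  simp [chi, h]

set_option synthInstance.maxSize 2000 in
set_option synthInstance.maxHeartbeats 400000 in
set_option maxRecDepth 10000 in
theorem bowtie_no_legal_system : ¬ HasLegalSystem bowtieGraph := by
  rintro ⟨S, M, hM, hL⟩
  have m0 := AddSubgroup.subset_closure (Set.mem_range_self (f := fun v => chi (M v)) 0)
  have m1 := AddSubgroup.subset_closure (Set.mem_range_self (f := fun v => chi (M v)) 1)
  have L0 := bt_legal _ (hL _ (zero_mem _))
  have L1 := bt_legal _ (hL _ m0)
  have L2 := bt_legal _ (hL _ m1)
  have L3 := bt_legal _ (hL _ (add_mem m0 m1))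
  have e00 : chi (M 0) 0 = 1 := chi_in (hM 0).1
  have e01 : chi (M 0) 1 = 0 := chi_out fun h => (hM 0).2 _ h (by simp [bowtieGraph])
  have e02 : chi (M 0) 2 = 0 := chi_out fun h => (hM 0).2 _ h (by simp [bowtieGraph])
  have e03 : chi (M 0) 3 = 0 := chi_out fun h => (hM 0).2 _ h (by simp [bowtieGraph])
  have e10 : chi (M 1) 0 = 0 := chi_out fun h => (hM 1).2 _ h (by simp [bowtieGraph])
  have e11 : chi (M 1) 1 = 1 := chi_in (hM 1).1
  have e12 : chi (M 1) 2 = 0 := chi_out fun h => (hM 1).2 _ h (by simp [bowtieGraph])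
  have A0 := L0 1 (by simp)
  have B0 := L0 2 (by simp)
  have A1 := L1 1 (by simp)
  have B1 := L1 2 (by simp)
  have A2 := L2 1 (by simp)
  have B2 := L2 2 (by simp)
  have A3 := L3 1 (by simp)
  have B3 := L3 2 (by simp)
  simp only [actSet, Set.mem_ofPred_eq, Pi.add_apply, Pi.zero_apply, e00, e01, e02, e03, e10,
    e11, e12] at A0 B0 A1 B1 A2 B2 A3 B3
  clear L0 L1 L2 L3 e00 e01 e02 e03 e10 e11 e12 m0 m1 hL hM
  generalize chi (M 1) 3 = m at *
  generalize chi S 0 = s0 at *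
  generalize chi S 1 = s1 at *
  generalize chi S 2 = s2 at *
  generalize chi S 3 = s3 at *
  clear M S
  revert m s0 s1 s2 s3
  decide
end

section
/- Let m ≥ 1 be an integer, let Y be a binomial random variable with parameters m and 1/2, set X = min(Y, m − Y), and let Z be a binomial random variable with parameters ⌊m/2⌋ and 1/2. Then X stochastically dominates Z: for every t ≥ 0 one has P(X ≤ t) ≤ P(Z ≤ t). Equivalently, for every natural number t, ∑_{j=0}^{m} 𝟙[min(j, m−j) ≤ t] · C(m,j) · 2^{−m} ≤ ∑_{j=0}^{t} C(⌊m/2⌋, j) · 2^{−⌊m/2⌋}, where C(a,b) denotes the binomial coefficient. -/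
def TT (n t : ℕ) : ℕ := ∑ j ∈ Finset.range t, n.choose j

lemma TT_succ (n t : ℕ) : TT (n+1) (t+1) = TT n (t+1) + TT n t := by
  unfold TT
  rw [Finset.sum_range_succ' _ t, Finset.sum_range_succ' (fun j => n.choose j) t]
  simp only [Nat.choose_succ_succ', Finset.sum_add_distrib, Nat.choose_zero_right]
  ring

lemma TT_mono (n t : ℕ) : TT n t ≤ TT n (t+1) := by
  unfold TT
  rw [Finset.sum_range_succ]; omega

lemma TT_two (n t : ℕ) : TT (n+1) t ≤ 2 * TT n t := by
  cases t with
  | zero => simp [TT]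
  | succ t =>
    have := TT_mono n t
    rw [TT_succ]; omega

lemma TT_main (n : ℕ) : ∀ t ≤ n, 2 * TT (2*n) t ≤ 2^n * TT n t := by
  induction n with
  | zero => intro t ht; obtain rfl : t = 0 := by omega
            simp [TT]
  | succ n ih =>
    intro t ht
    cases t with
    | zero => simp [TT]
    | succ t =>
      have e : 2 * (n+1) = 2*n+1+1 := by ring
      rw [e, TT_succ, TT_succ n t, pow_succ]
      have h0 := TT_succ (2*n) t
      have h1 := ih t (by omega)
      by_cases h : t + 1 ≤ n
      · have h2 := ih (t+1) h
        have h3 := TT_mono (2*n+1) t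
        nlinarith
      · obtain rfl : t = n := by omega
        have h2 : TT t (t+1) = 2^t := Nat.sum_range_choose t
        have h3 : TT (2*t+1) (t+1) = 4^t := Nat.sum_range_choose_halfway t
        have h4 := TT_two (2*t) t
        have h5 : (4:ℕ)^t = 2^t*2^t := by rw [← mul_pow]; norm_num
        rw [h2, h3, h5]
        nlinarith

lemma TT_main2 (m t : ℕ) (ht : t ≤ m/2) : 2 * TT m t * 2^(m/2) ≤ TT (m/2) t * 2^m := by
  have h := TT_main (m/2) t ht
  generalize hn : m/2 = n at *
  have key : 2 * TT (2*n) t * 2^n ≤ TT n t * 2^(2*n) := by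
    calc _ ≤ (2^n * TT n t) * 2^n := Nat.mul_le_mul_right _ h
      _ = _ := by ring
  rcases Nat.even_or_odd' m with ⟨k, rfl | rfl⟩
  · obtain rfl : k = n := by omega
    exact key
  · obtain rfl : k = n := by omega
    have h2 := TT_two (2*k) t
    calc _ ≤ 2 * (2 * TT (2*k) t) * 2^k := by gcongr
      _ = 2 * (2 * TT (2*k) t * 2^k) := by ring
      _ ≤ 2 * (TT k t * 2^(2*k)) := by gcongr
      _ = _ := by ring

lemma LHS_le (m t : ℕ) (ht : t < m + 1) :
    ∑ j ∈ Finset.range (m + 1), (if min j (m - j) ≤ t then m.choose j else 0)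
      ≤ 2 * TT m (t+1) := by
  have a : ∑ j ∈ Finset.range (m + 1), (if j ≤ t then m.choose j else 0) = TT m (t+1) := by
    unfold TT
    rw [← Finset.sum_filter]
    congr 1
    ext j; simp; omega
  have b : ∑ j ∈ Finset.range (m + 1), (if m - j ≤ t then m.choose j else 0) = TT m (t+1) := by
    rw [← a, ← Finset.sum_range_reflect]
    refine Finset.sum_congr rfl fun j hj => ?_
    have hj' : j ≤ m := by simp at hj; omega
    have e1 : m + 1 - 1 - j = m - j := by omega
    have e2 : m - (m - j) = j := by omega
    rw [e1, e2, Nat.choose_symm hj']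
  calc _ ≤ ∑ j ∈ Finset.range (m + 1), ((if j ≤ t then m.choose j else 0)
            + (if m - j ≤ t then m.choose j else 0)) := by
          refine Finset.sum_le_sum fun j _ => ?_
          by_cases h1 : j ≤ t <;> by_cases h2 : m - j ≤ t <;> simp [h1, h2]
    _ = _ := by rw [Finset.sum_add_distrib, a, b]; ring

theorem binomial_min_dominates (m : ℕ) (hm : 1 ≤ m) (t : ℕ) :
    ∑ j ∈ Finset.range (m + 1),
        (if min j (m - j) ≤ t then (m.choose j : ℝ) else 0) / 2 ^ m ≤
      ∑ j ∈ Finset.range (t + 1), ((m / 2).choose j : ℝ) / 2 ^ (m / 2) := by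
  rw [← Finset.sum_div, ← Finset.sum_div, div_le_div_iff₀ (by positivity) (by positivity)]
  suffices h : (∑ j ∈ Finset.range (m + 1), (if min j (m - j) ≤ t then m.choose j else 0))
      * 2^(m/2) ≤ TT (m/2) (t+1) * 2^m by
    unfold TT at h
    exact_mod_cast h
  by_cases ht : t + 1 ≤ m/2
  · exact (Nat.mul_le_mul_right _ (LHS_le m t (by omega))).trans (TT_main2 m (t+1) ht)
  · have h1 : 2^(m/2) ≤ TT (m/2) (t+1) := by
      rw [← Nat.sum_range_choose (m/2)]
      exact Finset.sum_le_sum_of_subset (Finset.range_mono (by omega))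
    have h2 : ∑ j ∈ Finset.range (m + 1), (if min j (m - j) ≤ t then m.choose j else 0)
        ≤ 2^m := by
      rw [← Nat.sum_range_choose m]
      refine Finset.sum_le_sum fun j _ => ?_
      split_ifs <;> simp
    calc _ ≤ 2^m * TT (m/2) (t+1) := Nat.mul_le_mul h2 h1
      _ = _ := by ring
end

section
/- Let k ≥ 1 and let m₁, …, m_k ≥ 1 be integers. Let Y₁, …, Y_k be independent random variables with Y_i binomial with parameters m_i and 1/2, and set X = ∑_{i=1}^{k} min(Y_i, m_i − Y_i). Let Z be a binomial random variable with parameters ∑_{i=1}^{k} ⌊m_i/2⌋ and 1/2. Then X stochastically dominates Z: for every t ≥ 0 one has P(X ≤ t) ≤ P(Z ≤ t). -/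
/-- Expectation of `f` under the symmetric binomial law, by recursion. -/
noncomputable def BinE : ℕ → (ℕ → ℝ) → ℝ
  | 0, f => f 0
  | n + 1, f => (BinE n f + BinE n (fun x => f (x + 1))) / 2

theorem BinE_mono (n : ℕ) : ∀ f g : ℕ → ℝ, (∀ y ≤ n, f y ≤ g y) → BinE n f ≤ BinE n g := by
  induction n with
  | zero => intro f g h; exact h 0 le_rfl
  | succ n ih =>
    intro f g h
    have h1 := ih f g (fun y hy => h y (by omega))
    have h2 := ih (fun x => f (x + 1)) (fun x => g (x + 1)) (fun y hy => h (y + 1) (by omega))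
    simp only [BinE]
    linarith

theorem BinE_add (b a : ℕ) : ∀ f : ℕ → ℝ,
    BinE (a + b) f = BinE a (fun x => BinE b (fun y => f (x + y))) := by
  induction a with
  | zero => intro f; simp [BinE]
  | succ a ih =>
    intro f
    rw [show a + 1 + b = (a + b) + 1 by ring]
    simp only [BinE]
    rw [ih, ih]
    simp only [add_right_comm]

theorem BinE_eq (n : ℕ) : ∀ f : ℕ → ℝ,
    BinE n f = ∑ y ∈ Finset.range (n + 1), (n.choose y : ℝ) / 2 ^ n * f y := by
  induction n with
  | zero => intro f; simp [BinE]
  | succ n ih =>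
    intro f
    simp only [BinE]
    rw [ih, ih, Finset.sum_range_succ' _ (n + 1)]
    have h : ∑ y ∈ Finset.range (n + 1), (n.choose y : ℝ) / 2 ^ n * f y
        = ∑ y ∈ Finset.range (n + 1), (n.choose (y + 1) : ℝ) / 2 ^ n * f (y + 1)
          + 1 / 2 ^ n * f 0 := by
      rw [Finset.sum_range_succ', Finset.sum_range_succ _ n]
      simp
    rw [h]
    have h2 : ∑ y ∈ Finset.range (n + 1), ((n + 1).choose (y + 1) : ℝ) / 2 ^ (n + 1) * f (y + 1)
        = (∑ y ∈ Finset.range (n + 1), (n.choose y : ℝ) / 2 ^ n * f (y + 1)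
          + ∑ y ∈ Finset.range (n + 1), (n.choose (y + 1) : ℝ) / 2 ^ n * f (y + 1)) / 2 := by
      rw [← Finset.sum_add_distrib, Finset.sum_div]
      refine Finset.sum_congr rfl fun y _ => ?_
      rw [Nat.choose_succ_succ]
      push_cast
      field_simp
      ring
    rw [h2]
    simp only [Nat.choose_zero_right, Nat.cast_one]
    field_simp
    ring

theorem BinE_min (m : ℕ) : ∀ f : ℕ → ℝ, Antitone f →
    BinE m (fun y => f (min y (m - y))) ≤ BinE (m / 2) f := by
  induction m using Nat.twoStepInduction with
  | zero => intro f _; simp [BinE]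
  | one => intro f _; simp [BinE]
  | more m ih _ =>
    intro f hf
    have hf' : Antitone (fun x => f (x + 1)) := fun a b h => hf (by omega)
    have h1 := ih f hf
    have h2 := ih _ hf'
    rw [show (m + 2) / 2 = m / 2 + 1 by omega]
    simp only [BinE]
    have a1 := BinE_mono m (fun y => f (min y (m + 2 - y))) (fun y => f (min y (m - y)))
      (fun y hy => hf (by omega))
    have a2 := BinE_mono m (fun y => f (min (y + 1) (m + 2 - (y + 1))))
      (fun y => f (min y (m - y) + 1)) (fun y hy => hf (by omega))
    have a3 := BinE_mono m (fun y => f (min (y + 1 + 1) (m + 2 - (y + 1 + 1))))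
      (fun y => f (min y (m - y))) (fun y hy => hf (by omega))
    linarith

theorem BinE_multi (k : ℕ) : ∀ (m : Fin k → ℕ) (f : ℕ → ℝ), Antitone f →
    ∑ y : (∀ i : Fin k, Fin (m i + 1)),
      (∏ i, ((m i).choose (y i : ℕ) : ℝ) / 2 ^ (m i)) *
        f (∑ i, min (y i : ℕ) (m i - (y i : ℕ))) ≤ BinE (∑ i, m i / 2) f := by
  induction k with
  | zero => intro m f _; simp [BinE]
  | succ k ih =>
    intro m f hf
    rw [← (Fin.consEquiv (fun i => Fin (m i + 1))).sum_comp, Fintype.sum_prod_type]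
    rw [Fin.sum_univ_succ (fun i => m i / 2), BinE_add]
    have hg : Antitone (fun x => BinE (∑ i : Fin k, m i.succ / 2) (fun y => f (x + y))) :=
      fun a b h => BinE_mono _ _ _ (fun y _ => hf (by omega))
    refine le_trans ?_ (BinE_min (m 0) _ hg)
    rw [BinE_eq, Finset.sum_range]
    apply Finset.sum_le_sum
    intro x _
    simp only [Fin.consEquiv, Equiv.coe_fn_mk, Fin.prod_univ_succ, Fin.sum_univ_succ,
      Fin.cons_zero, Fin.cons_succ, mul_assoc]
    rw [← Finset.mul_sum]
    refine mul_le_mul_of_nonneg_left ?_ (by positivity)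
    exact ih (fun i => m i.succ) (fun y => f (min (x : ℕ) (m 0 - x) + y))
      (fun a b h => hf (by omega))

theorem sum_binomial_min_dominates (k : ℕ) (hk : 1 ≤ k) (m : Fin k → ℕ)
    (hm : ∀ i, 1 ≤ m i) (t : ℕ) :
    ∑ y : (∀ i : Fin k, Fin (m i + 1)),
        (if (∑ i, min (y i : ℕ) (m i - (y i : ℕ))) ≤ t then
          ∏ i, ((m i).choose (y i : ℕ) : ℝ) / 2 ^ (m i) else 0) ≤
      ∑ j ∈ Finset.range (t + 1),
        ((∑ i, m i / 2).choose j : ℝ) / 2 ^ (∑ i, m i / 2) := by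
  have h := BinE_multi k m (fun x => if x ≤ t then 1 else 0) (by
    intro a b hab
    dsimp only
    split_ifs
    · exact le_rfl
    · omega
    · exact zero_le_one
    · exact le_rfl)
  simp only [mul_ite, mul_one, mul_zero] at h
  refine h.trans ?_
  rw [BinE_eq]
  simp only [mul_ite, mul_one, mul_zero]
  rw [← Finset.sum_filter]
  refine Finset.sum_le_sum_of_subset_of_nonneg ?_ (fun _ _ _ => by positivity)
  intro j hj
  simp only [Finset.mem_filter, Finset.mem_range] at hj ⊢
  omega
end

section
/- Let (p_n) be a sequence with log n / n < p_n < 3 log n / n for all large n, and let G ∼ 𝒢(n, p_n). Then asymptotically almost surely every subset A ⊆ V(G) such that the induced subgraph G[A] has minimum degree greater than (log log n)² satisfies |A| ≥ 2n log log n / log n. -/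
open SimpleGraph

open MeasureTheory Filter

/-- Bernoulli measure on `Bool` with success probability `p`. -/
noncomputable def bernoulliMeasure (p : ℝ) : Measure Bool :=
  ENNReal.ofReal p • Measure.dirac true + ENNReal.ofReal (1 - p) • Measure.dirac false

/-- The Erdős–Rényi measure `𝒢(n,p)`: the product over all (unordered) vertex pairs of
Bernoulli(p) indicators. -/
noncomputable def erdosRenyi (n : ℕ) (p : ℝ) : Measure (Sym2 (Fin n) → Bool) :=
  Measure.pi fun _ => bernoulliMeasure p

/-- The simple graph on `{1,…,n}` determined by an indicator `ω` of the edges. -/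
def graphOf {n : ℕ} (ω : Sym2 (Fin n) → Bool) : SimpleGraph (Fin n) where
  Adj u v := u ≠ v ∧ ω s(u, v) = true
  symm := by
    constructor
    intro u v h
    exact ⟨h.1.symm, by rw [Sym2.eq_swap]; exact h.2⟩
  loopless := ⟨fun v h => h.1 rfl⟩

instance {n : ℕ} (ω : Sym2 (Fin n) → Bool) : DecidableRel (graphOf ω).Adj :=
  fun u v => inferInstanceAs (Decidable (u ≠ v ∧ ω s(u, v) = true))

lemma choose_bound (n k : ℕ) (hk : 1 ≤ k) :
    (n.choose k : ℝ) ≤ (Real.exp 1 * n / k) ^ k := by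
  have hk0 : (0 : ℝ) < k := by exact_mod_cast hk
  have h1 : (n.choose k : ℝ) ≤ (n : ℝ) ^ k / (k.factorial : ℝ) := Nat.choose_le_pow_div k n
  have h2 := Real.pow_div_factorial_le_exp (k : ℝ) hk0.le k
  have hf : (0 : ℝ) < k.factorial := by exact_mod_cast k.factorial_pos
  refine h1.trans ?_
  rw [div_pow, mul_pow, ← Real.exp_nat_mul, mul_one, div_le_div_iff₀ hf (by positivity)]
  rw [div_le_iff₀ hf] at h2
  have := mul_le_mul_of_nonneg_left h2 (by positivity : (0 : ℝ) ≤ (n : ℝ) ^ k)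
  linarith

lemma key_bound (n k N m : ℕ) (l L p : ℝ) (hl : 100 ≤ l) (hL : L = Real.exp l) (hn : 0 < n)
    (hk : 1 ≤ k) (hkK : (k : ℝ) * L < 2 * n * l) (hp0 : 0 ≤ p) (hp : p ≤ 3 * L / n)
    (hN : N ≤ k ^ 2) (hm : k * l ^ 2 / 2 ≤ (m : ℝ)) :
    (n.choose k : ℝ) * ((N.choose m : ℝ) * p ^ m) ≤ (6 * Real.exp (3 + l - l ^ 2 / 2)) ^ k := by
  have hk0 : (0 : ℝ) < k := by exact_mod_cast hk
  have hn0 : (0 : ℝ) < n := by exact_mod_cast hn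
  have hl0 : 0 < l := by linarith
  have hL0 : 0 < L := hL ▸ Real.exp_pos l
  have hm0 : (0 : ℝ) < m := lt_of_lt_of_le (by positivity) hm
  have hm1 : 1 ≤ m := by exact_mod_cast hm0
  have he : Real.exp 1 < 2.72 := by have := Real.exp_one_lt_d9; linarith
  have he0 := Real.exp_pos 1
  set e := Real.exp 1 with hedef
  set b : ℝ := 6 * e * k * L / (n * l ^ 2) with hb
  have hb0 : 0 < b := by positivity
  have hbe : b ≤ Real.exp (-1) := by
    rw [Real.exp_neg, ← hedef, hb, div_le_iff₀ (by positivity), inv_mul_eq_div, le_div_iff₀ he0]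
    have h1 : 6 * e * k * L * e ≤ 6 * e * e * (2 * n * l) := by
      have := mul_le_mul_of_nonneg_left hkK.le (by positivity : 0 ≤ 6 * e * e)
      linarith
    have h2 : 12 * (e * e) ≤ l := by nlinarith
    have h3 := mul_le_mul_of_nonneg_right h2 (by positivity : 0 ≤ n * l)
    nlinarith
  have hb1 : b ≤ 1 := hbe.trans (by rw [Real.exp_le_one_iff]; norm_num)
  -- edge factor
  have hE : (N.choose m : ℝ) * p ^ m ≤ b ^ m := by
    have h1 := choose_bound N m hm1
    have h2 : (N.choose m : ℝ) * p ^ m ≤ (e * N / m * p) ^ m := by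
      rw [mul_pow]; gcongr
    refine h2.trans ?_
    gcongr
    have hN' : (N : ℝ) ≤ (k : ℝ) ^ 2 := by exact_mod_cast hN
    calc e * N / m * p ≤ e * (k : ℝ) ^ 2 / (k * l ^ 2 / 2) * (3 * L / n) := by gcongr
      _ = b := by rw [hb]; field_simp; ring
  have hE2 : b ^ m ≤ (b * Real.exp (-(l ^ 2 / 2 - 1))) ^ k := by
    have h1 : b ^ m ≤ b ^ ((l ^ 2 / 2) * (k : ℝ)) := by
      rw [← Real.rpow_natCast b m]
      apply Real.rpow_le_rpow_of_exponent_ge hb0 hb1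
      linarith
    rw [Real.rpow_mul hb0.le, Real.rpow_natCast] at h1
    refine h1.trans ?_
    gcongr
    have h2 : b ^ (l ^ 2 / 2) = b * b ^ (l ^ 2 / 2 - 1) := by
      rw [Real.rpow_sub_one hb0.ne']; field_simp
    rw [h2]
    gcongr
    calc b ^ (l ^ 2 / 2 - 1) ≤ (Real.exp (-1)) ^ (l ^ 2 / 2 - 1) := by
          apply Real.rpow_le_rpow hb0.le hbe; nlinarith
      _ = Real.exp (-(l ^ 2 / 2 - 1)) := by rw [← Real.exp_mul]; ring_nf
  calc (n.choose k : ℝ) * ((N.choose m : ℝ) * p ^ m)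
      ≤ (e * n / k) ^ k * (b * Real.exp (-(l ^ 2 / 2 - 1))) ^ k := by
        gcongr
        · exact choose_bound n k hk
        · exact hE.trans hE2
    _ = (e * n / k * (b * Real.exp (-(l ^ 2 / 2 - 1)))) ^ k := (mul_pow _ _ _).symm
    _ ≤ _ := by
        refine pow_le_pow_left₀ (by positivity) ?_ k
        have h3 : e * n / k * b = 6 * e * e * L / l ^ 2 := by rw [hb]; field_simp
        rw [← mul_assoc, h3]
        have h4 : 6 * e * e * L / l ^ 2 ≤ 6 * e * e * L := by
          apply div_le_self (by positivity); nlinarith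
        calc _ ≤ 6 * e * e * L * Real.exp (-(l ^ 2 / 2 - 1)) := by gcongr
          _ = _ := by
            have : (3 + l - l ^ 2 / 2) = 1 + 1 + l + (-(l ^ 2 / 2 - 1)) := by ring
            rw [this, Real.exp_add, Real.exp_add, Real.exp_add, hL]; ring

lemma edges_lower {n : ℕ} (ω : Sym2 (Fin n) → Bool) (A : Finset (Fin n)) (d : ℝ)
    (h : ∀ v ∈ A, d < ((A.filter fun u => (graphOf ω).Adj v u).card : ℝ)) :
    A.card * d / 2 ≤ ((A.sym2.filter fun e => ω e = true).card : ℝ) := by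
  classical
  set P := (A ×ˢ A).filter (fun x => (graphOf ω).Adj x.1 x.2) with hP
  have h1 : P.card = ∑ v ∈ A, (A.filter fun u => (graphOf ω).Adj v u).card := by
    rw [hP, Finset.card_filter, Finset.sum_product]
    simp only [Finset.card_filter]
  have h2 : P.card ≤ 2 * (A.sym2.filter fun e => ω e = true).card := by
    apply Finset.card_le_mul_card_image_of_maps_to (f := fun x => s(x.1, x.2))
    · rintro ⟨a, b⟩ hx
      simp only [hP, Finset.mem_filter, Finset.mem_product] at hx
      simp only [Finset.coe_filter, Set.mem_ofPred_eq, Finset.mem_filter, Finset.mk_mem_sym2_iff]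
      exact ⟨hx.1, hx.2.2⟩
    · intro e _
      induction e with
      | _ a b =>
        refine (Finset.card_le_card (t := {(a, b), (b, a)}) ?_).trans Finset.card_le_two
        rintro ⟨x, y⟩ hx
        simp only [Finset.mem_filter, Sym2.eq_iff] at hx
        simp only [Finset.mem_insert, Finset.mem_singleton, Prod.mk.injEq]
        exact hx.2
  have h3 : A.card * d ≤ (P.card : ℝ) := by
    rw [h1]; push_cast
    rw [← nsmul_eq_mul]
    exact Finset.card_nsmul_le_sum _ _ _ fun v hv => (h v hv).le
  have h2' : (P.card : ℝ) ≤ 2 * ((A.sym2.filter fun e => ω e = true).card : ℝ) := by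
    exact_mod_cast h2
  linarith

lemma bern_prob (p : ℝ) (h0 : 0 ≤ p) (h1 : p ≤ 1) : IsProbabilityMeasure (bernoulliMeasure p) := by
  constructor
  simp only [bernoulliMeasure, Measure.coe_add, Measure.coe_smul, Pi.add_apply, Pi.smul_apply,
    measure_univ, smul_eq_mul, mul_one]
  rw [← ENNReal.ofReal_add h0 (by linarith)]
  simp

lemma box_measure (n : ℕ) (p : ℝ) (h0 : 0 ≤ p) (h1 : p ≤ 1) (S : Finset (Sym2 (Fin n))) :
    erdosRenyi n p {ω | ∀ e ∈ S, ω e = true} = ENNReal.ofReal (p ^ S.card) := by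
  classical
  have := bern_prob p h0 h1
  have : {ω : Sym2 (Fin n) → Bool | ∀ e ∈ S, ω e = true}
      = Set.univ.pi (fun e => if e ∈ S then {true} else Set.univ) := by
    ext ω
    simp only [Set.mem_ofPred_eq, Set.mem_pi, Set.mem_univ, true_imp_iff]
    refine forall_congr' fun e => ?_
    by_cases he : e ∈ S <;> simp [he]
  rw [this, erdosRenyi, Measure.pi_pi]
  have h2 : ∀ e, bernoulliMeasure p (if e ∈ S then {true} else Set.univ)
      = if e ∈ S then ENNReal.ofReal p else 1 := by
    intro e
    by_cases he : e ∈ S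
    · simp [he, bernoulliMeasure]
    · rw [if_neg he, if_neg he]; exact measure_univ
  simp only [h2]
  rw [Finset.prod_ite_mem, Finset.univ_inter, Finset.prod_const, ENNReal.ofReal_pow h0]

lemma set_measure (n : ℕ) (p : ℝ) (h0 : 0 ≤ p) (h1 : p ≤ 1) (A : Finset (Fin n)) (m : ℕ) :
    erdosRenyi n p {ω | m ≤ (A.sym2.filter fun e => ω e = true).card}
      ≤ ENNReal.ofReal ((A.sym2.card.choose m : ℝ) * p ^ m) := by
  classical
  have hsub : {ω : Sym2 (Fin n) → Bool | m ≤ (A.sym2.filter fun e => ω e = true).card}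
      ⊆ ⋃ S ∈ A.sym2.powersetCard m, {ω | ∀ e ∈ S, ω e = true} := by
    intro ω hω
    obtain ⟨S, hS, hc⟩ := Finset.exists_subset_card_eq (Set.mem_ofPred_eq ▸ hω)
    simp only [Set.mem_iUnion, Finset.mem_powersetCard]
    exact ⟨S, ⟨hS.trans (Finset.filter_subset _ _), hc⟩,
      fun e he => (Finset.mem_filter.1 (hS he)).2⟩
  refine (measure_mono hsub).trans ((measure_biUnion_finset_le _ _).trans ?_)
  rw [Finset.sum_congr rfl (g := fun _ => ENNReal.ofReal (p ^ m))]
  · rw [Finset.sum_const, Finset.card_powersetCard, nsmul_eq_mul,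
      ENNReal.ofReal_mul (by positivity), ENNReal.ofReal_natCast]
  · intro S hS
    rw [box_measure n p h0 h1, (Finset.mem_powersetCard.1 hS).2]

lemma bad_measure (n : ℕ) (p : ℝ) (hn : 0 < n) (h0 : 0 ≤ p) (h1 : p ≤ 1)
    (hp : p ≤ 3 * Real.log n / n)
    (hL : 0 < Real.log n) (hl : 100 ≤ Real.log (Real.log n))
    (q : ℝ) (hq : q = 6 * Real.exp (3 + Real.log (Real.log n) - Real.log (Real.log n) ^ 2 / 2))
    (hq2 : q ≤ 1 / 2) :
    erdosRenyi n p
          {ω | ∀ A : Finset (Fin n), A.Nonempty →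
            (∀ v ∈ A, (Real.log (Real.log n)) ^ 2 <
              ((A.filter fun u => (graphOf ω).Adj v u).card : ℝ)) →
            2 * n * Real.log (Real.log n) / Real.log n ≤ (A.card : ℝ)}ᶜ
      ≤ ENNReal.ofReal (2 * q) := by
  classical
  set l := Real.log (Real.log n) with hldef
  set L := Real.log n with hLdef
  have hLe : L = Real.exp l := (Real.exp_log hL).symm
  have hq0 : 0 ≤ q := by rw [hq]; positivity
  let M : ℕ → ℕ := fun k => ⌈(k : ℝ) * l ^ 2 / 2⌉₊
  let T : Finset (Finset (Fin n)) :=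
    Finset.univ.filter fun A => A.Nonempty ∧ (A.card : ℝ) < 2 * n * l / L
  have hsub : {ω | ∀ A : Finset (Fin n), A.Nonempty →
            (∀ v ∈ A, l ^ 2 < ((A.filter fun u => (graphOf ω).Adj v u).card : ℝ)) →
            2 * n * l / L ≤ (A.card : ℝ)}ᶜ
      ⊆ ⋃ A ∈ T, {ω | M A.card ≤ (A.sym2.filter fun e => ω e = true).card} := by
    intro ω hω
    simp only [Set.mem_compl_iff, Set.mem_ofPred_eq, not_forall, not_le] at hω
    obtain ⟨A, hA, hd, hc⟩ := hω
    simp only [Set.mem_iUnion]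
    refine ⟨A, by simp only [T, Finset.mem_filter, Finset.mem_univ, true_and]; exact ⟨hA, hc⟩, ?_⟩
    exact Nat.ceil_le.2 (edges_lower ω A _ hd)
  let g : ℕ → ℝ := fun k => if k = 0 then 0 else q ^ k / (n.choose k : ℝ)
  have hg0 : ∀ k, 0 ≤ g k := by
    intro k; simp only [g]; split_ifs <;> positivity
  refine (measure_mono hsub).trans ((measure_biUnion_finset_le _ _).trans ?_)
  have hT : ∀ A ∈ T, erdosRenyi n p {ω | M A.card ≤ (A.sym2.filter fun e => ω e = true).card}
      ≤ ENNReal.ofReal (g A.card) := by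
    intro A hA
    simp only [T, Finset.mem_filter, Finset.mem_univ, true_and] at hA
    refine (set_measure n p h0 h1 A _).trans (ENNReal.ofReal_le_ofReal ?_)
    have hk : 1 ≤ A.card := hA.1.card_pos
    have hkn : A.card ≤ n := by simpa using A.card_le_univ
    have hch : (0 : ℝ) < n.choose A.card := by exact_mod_cast Nat.choose_pos hkn
    have hN : A.sym2.card ≤ A.card ^ 2 := by
      rw [Finset.card_sym2, Nat.choose_two_right]
      apply Nat.div_le_of_le_mul
      simp only [Nat.add_sub_cancel]
      nlinarith
    have := key_bound n A.card A.sym2.card (M A.card) l L p hl hLe hn hk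
      ((lt_div_iff₀ hL).1 hA.2) h0 hp hN (Nat.le_ceil _)
    rw [← hq] at this
    simp only [g, if_neg (by omega : A.card ≠ 0)]
    rw [le_div_iff₀ hch]
    linarith
  refine (Finset.sum_le_sum hT).trans ?_
  rw [← ENNReal.ofReal_sum_of_nonneg (fun A _ => hg0 _)]
  apply ENNReal.ofReal_le_ofReal
  calc ∑ A ∈ T, g A.card ≤ ∑ A ∈ (Finset.univ : Finset (Fin n)).powerset, g A.card := by
        apply Finset.sum_le_sum_of_subset_of_nonneg
        · intro A _; simp
        · intro A _ _; exact hg0 _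
    _ = ∑ k ∈ Finset.range (n + 1), (n.choose k) • g k := by
        rw [Finset.sum_powerset_apply_card]; simp
    _ = ∑ k ∈ Finset.range n, q ^ (k + 1) := by
        rw [Finset.sum_range_succ']
        simp only [g, if_true, smul_zero, add_zero]
        refine Finset.sum_congr rfl fun k hk => ?_
        have hk' := Finset.mem_range.1 hk
        have hch : (0 : ℝ) < n.choose (k + 1) := by exact_mod_cast Nat.choose_pos hk'
        rw [if_neg (by omega), nsmul_eq_mul]
        field_simp
    _ = q * ∑ k ∈ Finset.range n, q ^ k := by
        rw [Finset.mul_sum]; refine Finset.sum_congr rfl fun k _ => ?_; ring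
    _ ≤ q * 2 := by
        gcongr
        calc ∑ k ∈ Finset.range n, q ^ k ≤ ∑ k ∈ Finset.range n, (1 / 2 : ℝ) ^ k := by gcongr
          _ ≤ 2 := sum_geometric_two_le n
    _ = 2 * q := by ring

theorem aas_min_degree_sets_are_large (p : ℕ → ℝ)
    (hp : ∀ᶠ n : ℕ in atTop, Real.log n / n < p n ∧ p n < 3 * Real.log n / n) :
    Tendsto (fun n : ℕ =>
        erdosRenyi n (p n)
          {ω | ∀ A : Finset (Fin n), A.Nonempty →
            (∀ v ∈ A, (Real.log (Real.log n)) ^ 2 <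
              ((A.filter fun u => (graphOf ω).Adj v u).card : ℝ)) →
            2 * n * Real.log (Real.log n) / Real.log n ≤ (A.card : ℝ)})
      atTop (nhds 1) := by
  have hlog : Tendsto (fun n : ℕ => Real.log n) atTop atTop :=
    Real.tendsto_log_atTop.comp tendsto_natCast_atTop_atTop
  have hloglog : Tendsto (fun n : ℕ => Real.log (Real.log n)) atTop atTop :=
    Real.tendsto_log_atTop.comp hlog
  let qf : ℝ → ℝ := fun l => 6 * Real.exp (3 + l - l ^ 2 / 2)
  have hqf : Tendsto qf atTop (nhds 0) := by
    have h1 : Tendsto (fun l : ℝ => 3 + l - l ^ 2 / 2) atTop atBot := by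
      refine tendsto_atBot_mono' atTop (f₂ := fun l : ℝ => 3 + l - l ^ 2 / 2)
        (f₁ := fun l : ℝ => -l) ?_ tendsto_neg_atTop_atBot
      filter_upwards [eventually_ge_atTop 100] with l hl
      nlinarith
    have h2 := (Real.tendsto_exp_atBot.comp h1).const_mul 6
    simpa [qf] using h2
  have hq := hqf.comp hloglog
  have hlim : Tendsto (fun n : ℕ => 1 - ENNReal.ofReal (2 * qf (Real.log (Real.log n)))) atTop
      (nhds 1) := by
    have h1 : Tendsto (fun n : ℕ => ENNReal.ofReal (2 * qf (Real.log (Real.log n)))) atTop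
        (nhds 0) := by
      have := ENNReal.tendsto_ofReal (hq.const_mul 2)
      simpa using this
    have := ENNReal.Tendsto.sub (tendsto_const_nhds (x := (1 : ENNReal)) (f := atTop)) h1
      (Or.inl ENNReal.one_ne_top)
    simpa using this
  have hsmall : ∀ᶠ n : ℕ in atTop, 3 * Real.log n / n ≤ 1 := by
    have h1 := Real.isLittleO_log_id_atTop.bound (by norm_num : (0 : ℝ) < 1 / 3)
    filter_upwards [tendsto_natCast_atTop_atTop.eventually h1, eventually_gt_atTop 0,
      hlog.eventually_gt_atTop 0] with n hn hn0 hl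
    have hn0' : (0 : ℝ) < n := by exact_mod_cast hn0
    simp only [id, Real.norm_eq_abs, abs_of_pos hl, abs_of_pos hn0'] at hn
    rw [div_le_one hn0']
    linarith
  have hprob : ∀ᶠ n : ℕ in atTop, 0 ≤ p n ∧ p n ≤ 1 := by
    filter_upwards [hp, hsmall, hlog.eventually_gt_atTop 0] with n h1 h2 h3
    exact ⟨(by positivity : (0 : ℝ) ≤ Real.log n / n).trans h1.1.le, h1.2.le.trans h2⟩
  refine tendsto_of_tendsto_of_tendsto_of_le_of_le' hlim tendsto_const_nhds ?_ ?_
  · filter_upwards [hp, hprob, eventually_gt_atTop 0, hlog.eventually_gt_atTop 0,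
      hloglog.eventually_ge_atTop 100, hq.eventually_le_const (by norm_num : (0 : ℝ) < 1 / 2)]
      with n h1 h2 h3 h4 h5 h6
    have := bern_prob (p n) h2.1 h2.2
    have : IsProbabilityMeasure (erdosRenyi n (p n)) := by
      unfold erdosRenyi; infer_instance
    have hb := bad_measure n (p n) h3 h2.1 h2.2 h1.2.le h4 h5 _ rfl h6
    have hm : ∀ s : Set (Sym2 (Fin n) → Bool), MeasurableSet s := fun s =>
      s.toFinite.measurableSet
    rw [prob_compl_eq_one_sub (hm _)] at hb
    exact tsub_le_iff_tsub_le.1 hb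
  · filter_upwards [hprob] with n h2
    have := bern_prob (p n) h2.1 h2.2
    have : IsProbabilityMeasure (erdosRenyi n (p n)) := by
      unfold erdosRenyi; infer_instance
    exact prob_le_one
end

section
/- Let (p_n) be a sequence with 0.99 ≤ p_n < 1 for all n and n²(1 − p_n) → ∞ as n → ∞, and let G ∼ 𝒢(n, p_n). Then asymptotically almost surely G has a legal system. -/
open SimpleGraph

open MeasureTheory Filter

open Finset in
lemma legal_of_comb {n : ℕ} (ω : Sym2 (Fin n) → Bool) (D : ℕ)
    (hD : ∀ v, (univ.filter fun u => u ≠ v ∧ ω s(v, u) = false).card ≤ D)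
    (hE : 4 * D ^ 2 < (univ.filter fun e : Sym2 (Fin n) => ¬ e.IsDiag ∧ ω e = false).card) :
    HasLegalSystem (graphOf ω) := by
  classical
  set Nb : Fin n → Finset (Fin n) := fun v => univ.filter fun u => u ≠ v ∧ ω s(v, u) = false with hNb
  set E := univ.filter fun e : Sym2 (Fin n) => ¬ e.IsDiag ∧ ω e = false with hEdef
  -- the maximal matching
  let P : Finset (Equiv.Perm (Fin n)) :=
    univ.filter fun σ => (∀ v, σ (σ v) = v) ∧ ∀ v, σ v ≠ v → ω s(v, σ v) = false
  have hP : P.Nonempty := ⟨1, by simp [P]⟩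
  obtain ⟨σ, hσP, hmax⟩ := P.exists_max_image (fun σ => σ.support.card) hP
  obtain ⟨hinv, hadj⟩ : (∀ v, σ (σ v) = v) ∧ ∀ v, σ v ≠ v → ω s(v, σ v) = false := by
    simpa [P] using hσP
  have hcover : ∀ u v, u ≠ v → ω s(u, v) = false → σ u ≠ u ∨ σ v ≠ v := by
    intro u v huv hw
    by_contra! hc
    obtain ⟨hu, hv⟩ := hc
    have hval : ∀ x, (σ * Equiv.swap u v) x = if x = u then v else if x = v then u else σ x := by
      intro x
      simp only [Equiv.Perm.mul_apply, Equiv.swap_apply_def]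
      split_ifs <;> simp_all
    have hne : ∀ x, x ≠ u → x ≠ v → σ x ≠ u ∧ σ x ≠ v := by
      intro x hxu hxv
      constructor
      · intro h; apply hxu; rw [← hinv x, h, hu]
      · intro h; apply hxv; rw [← hinv x, h, hv]
    have hmem : σ * Equiv.swap u v ∈ P := by
      simp only [P, mem_filter, mem_univ, true_and]
      refine ⟨fun x => ?_, fun x => ?_⟩
      · rw [hval x]
        by_cases h1 : x = u
        · subst h1; simp [hval, huv.symm]
        · by_cases h2 : x = v
          · subst h2; simp [hval, h1]
          · have := hne x h1 h2
            simp [hval, h1, h2, this, hinv]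
      · rw [hval x]
        by_cases h1 : x = u
        · subst h1; simp [hw]
        · by_cases h2 : x = v
          · subst h2; simp [h1, Sym2.eq_swap (a := x), hw]
          · simp only [h1, h2, if_false]; exact hadj x
    have hlt := hmax _ hmem
    have hss : insert u σ.support ⊆ (σ * Equiv.swap u v).support := by
      intro x hx
      rw [Equiv.Perm.mem_support, hval]
      rcases mem_insert.1 hx with h | h
      · simp [h, huv.symm]
      · rw [Equiv.Perm.mem_support] at h
        have h1 : x ≠ u := by rintro rfl; exact h hu
        have h2 : x ≠ v := by rintro rfl; exact h hv
        simpa [h1, h2] using h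
    have h3 := card_le_card hss
    rw [card_insert_of_notMem (by simp [hu])] at h3
    omega
  have hEle : E.card ≤ σ.support.card * D := by
    have hsub : E ⊆ σ.support.biUnion fun v => (Nb v).image fun u => s(v, u) := by
      intro e
      induction e using Sym2.ind with
      | _ u v =>
        intro he
        simp only [hEdef, mem_filter, mem_univ, true_and, Sym2.mk_isDiag_iff] at he
        simp only [mem_biUnion, mem_image, hNb, mem_filter, mem_univ, true_and,
          Equiv.Perm.mem_support]
        rcases hcover u v he.1 he.2 with h | h
        · exact ⟨u, h, v, ⟨fun h => he.1 h.symm, he.2⟩, rfl⟩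
        · exact ⟨v, h, u, ⟨he.1, by rw [Sym2.eq_swap]; exact he.2⟩, Sym2.eq_swap⟩
    refine (card_le_card hsub).trans (card_biUnion_le_card_mul _ _ _ fun v _ => ?_)
    exact card_image_le.trans (hD v)
  have hsupp : 4 * D < σ.support.card := by
    by_contra! h
    have := Nat.mul_le_mul_right D h
    nlinarith
  -- connectedness of transversals
  have hbig : ∀ T : Set (Fin n), (∀ v, σ v ≠ v → (v ∈ T ∨ σ v ∈ T)) →
      T.Nonempty ∧ ((graphOf ω).induce T).Connected := by
    intro T hT
    have hc : 2 * D < T.toFinset.card := by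
      have hsub : σ.support ⊆ T.toFinset ∪ T.toFinset.image σ := by
        intro v hv
        rw [Equiv.Perm.mem_support] at hv
        rcases hT v hv with h | h
        · simp [h]
        · rw [mem_union]; right
          exact mem_image.2 ⟨σ v, by simpa using h, hinv v⟩
      have h1 := (card_le_card hsub).trans (card_union_le _ _)
      have h2 : (T.toFinset.image σ).card ≤ T.toFinset.card := card_image_le
      omega
    have hne : T.Nonempty := by
      have : T.toFinset.Nonempty := card_pos.1 (by omega)
      simpa using this
    refine ⟨hne, ?_⟩
    have : Nonempty T := hne.to_subtype
    refine SimpleGraph.Connected.mk ?_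
    rintro ⟨a, ha⟩ ⟨b, hb⟩
    by_cases hab : a = b
    · subst hab; exact SimpleGraph.Reachable.refl _
    by_cases hw : ω s(a, b) = true
    · exact SimpleGraph.Adj.reachable (by exact ⟨hab, hw⟩)
    have hw' : ω s(a, b) = false := by simpa using hw
    have hex : ∃ c ∈ T.toFinset, c ∉ Nb a ∪ Nb b := by
      by_contra! h
      have h1 := (card_le_card (show T.toFinset ⊆ Nb a ∪ Nb b from h)).trans (card_union_le _ _)
      have := hD a
      have := hD b
      simp only [hNb] at h1
      omega
    obtain ⟨c, hcT, hc⟩ := hex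
    have hcT : c ∈ T := by simpa using hcT
    simp only [hNb, mem_union, mem_filter, mem_univ, true_and, not_or, not_and,
      Bool.not_eq_false] at hc
    have hca : c ≠ a := by
      rintro rfl
      have := hc.2 hab
      rw [Sym2.eq_swap, hw'] at this
      simp at this
    have hcb : c ≠ b := by
      rintro rfl
      have := hc.1 (Ne.symm hab)
      rw [hw'] at this
      simp at this
    have r1 : ((graphOf ω).induce T).Adj ⟨a, ha⟩ ⟨c, hcT⟩ := ⟨hca.symm, hc.1 hca⟩
    have r2 : ((graphOf ω).induce T).Adj ⟨b, hb⟩ ⟨c, hcT⟩ := ⟨hcb.symm, hc.2 hcb⟩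
    exact r1.reachable.trans r2.symm.reachable
  refine ⟨{v | v < σ v}, fun v => {v, σ v}, ?_, ?_⟩
  · intro v
    refine ⟨by simp, ?_⟩
    rintro u (rfl | hu)
    · simp
    · rw [Set.mem_singleton_iff] at hu
      subst hu
      rintro ⟨h1, h2⟩
      rw [hadj v h1.symm] at h2
      simp at h2
  · intro g hg
    have hgs : ∀ v, g (σ v) = g v := by
      induction hg using AddSubgroup.closure_induction with
      | mem x hx =>
        obtain ⟨w, rfl⟩ := hx
        intro v
        have : σ v ∈ ({w, σ w} : Set (Fin n)) ↔ v ∈ ({w, σ w} : Set (Fin n)) := by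
          simp only [Set.mem_insert_iff, Set.mem_singleton_iff, σ.injective.eq_iff]
          constructor
          · rintro (h | h)
            · right; rw [← h, hinv]
            · exact Or.inl h
          · rintro (h | h)
            · exact Or.inr h
            · left; rw [h, hinv]
        simp only [chi, Set.indicator, this]
        split_ifs <;> rfl
      | zero => simp
      | add x y _ _ hx hy => intro v; simp [hx v, hy v]
      | neg x _ hx => intro v; simp [hx v]
    have hflip : ∀ v, σ v ≠ v → (σ v ∈ actSet g {v | v < σ v} ↔ v ∉ actSet g {v | v < σ v}) := by
      intro v hv
      simp only [actSet, Set.mem_ofPred_eq, hgs, chi, Set.indicator, hinv, Pi.one_apply]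
      generalize g v = z
      rcases lt_or_gt_of_ne hv with h | h
      · simp only [h, not_lt_of_gt h, if_true, if_false]
        revert z; decide
      · simp only [h, not_lt_of_gt h, if_true, if_false]
        revert z; decide
    have h1 := hbig (actSet g {v | v < σ v}) (fun v hv => by
      rw [hflip v hv]; tauto)
    have h2 := hbig (actSet g {v | v < σ v})ᶜ (fun v hv => by
      rw [Set.mem_compl_iff, Set.mem_compl_iff, hflip v hv]; tauto)
    exact ⟨h1.1, h2.1, h1.2, h2.2⟩

lemma bern_integral (p : ℝ) (h0 : 0 ≤ p) (h1 : p ≤ 1) (f : Bool → ℝ) :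
    ∫ x, f x ∂(bernoulliMeasure p) = p * f true + (1 - p) * f false := by
  have i1 : IsFiniteMeasure (ENNReal.ofReal p • Measure.dirac true) :=
    Measure.smul_finite _ ENNReal.ofReal_ne_top
  have i2 : IsFiniteMeasure (ENNReal.ofReal (1 - p) • Measure.dirac false) :=
    Measure.smul_finite _ ENNReal.ofReal_ne_top
  rw [bernoulliMeasure, integral_add_measure (Integrable.of_finite) (Integrable.of_finite),
    integral_smul_measure, integral_smul_measure, integral_dirac, integral_dirac,
    ENNReal.toReal_ofReal h0, ENNReal.toReal_ofReal (by linarith)]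
  simp

lemma er_mgf (n : ℕ) (p : ℝ) (h0 : 0 ≤ p) (h1 : p ≤ 1) (I : Finset (Sym2 (Fin n))) (s : ℝ) :
    ProbabilityTheory.mgf (fun ω => ((I.filter fun e => ω e = false).card : ℝ))
      (erdosRenyi n p) s = (p + (1 - p) * Real.exp s) ^ I.card := by
  classical
  have := bern_prob p h0 h1
  have key : ∀ ω : Sym2 (Fin n) → Bool,
      Real.exp (s * ((I.filter fun e => ω e = false).card : ℝ)) =
      ∏ e, (fun (e : Sym2 (Fin n)) (b : Bool) =>
        if e ∈ I then (if b = false then Real.exp s else 1) else 1) e (ω e) := by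
    intro ω
    simp only [Finset.prod_ite_mem, Finset.univ_inter]
    rw [← Finset.prod_filter, Finset.prod_const, ← Real.exp_nat_mul, mul_comm]
  simp only [ProbabilityTheory.mgf, key]
  rw [erdosRenyi, integral_fintype_prod_eq_prod (fun (e : Sym2 (Fin n)) (b : Bool) =>
        if e ∈ I then (if b = false then Real.exp s else 1) else 1)]
  have h2 : ∀ e : Sym2 (Fin n), ∫ b, (if e ∈ I then (if b = false then Real.exp s else 1) else 1)
      ∂(bernoulliMeasure p) = if e ∈ I then (p + (1 - p) * Real.exp s) else 1 := by
    intro e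
    rw [bern_integral p h0 h1]
    split_ifs <;> simp_all
  simp only [h2]
  rw [Finset.prod_ite_mem, Finset.univ_inter, Finset.prod_const]

lemma er_mgf_le (n : ℕ) (p : ℝ) (h0 : 0 ≤ p) (h1 : p ≤ 1) (I : Finset (Sym2 (Fin n))) (s : ℝ) :
    ProbabilityTheory.mgf (fun ω => ((I.filter fun e => ω e = false).card : ℝ))
      (erdosRenyi n p) s ≤ Real.exp (I.card * ((1 - p) * (Real.exp s - 1))) := by
  rw [er_mgf n p h0 h1, Real.exp_nat_mul]
  have := Real.exp_pos s
  apply pow_le_pow_left₀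
  · have := mul_nonneg (by linarith : 0 ≤ 1 - p) this.le
    linarith
  · have := Real.add_one_le_exp ((1 - p) * (Real.exp s - 1))
    nlinarith

lemma er_prob (n : ℕ) (p : ℝ) (h0 : 0 ≤ p) (h1 : p ≤ 1) :
    IsProbabilityMeasure (erdosRenyi n p) := by
  have := bern_prob p h0 h1
  unfold erdosRenyi
  infer_instance

open Finset in
lemma bad_bound (n : ℕ) (p : ℝ) (h0 : 0 ≤ p) (h1 : p ≤ 1) (t s a : ℝ) (hs : 0 ≤ s) (ha : 0 ≤ a)
    (hn : 0 < n) :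
    1 - (Real.exp (a * (4 * t ^ 2) + (n * (n - 1) / 2) * ((1 - p) * (Real.exp (-a) - 1)))
      + n * Real.exp (-s * t + n * ((1 - p) * (Real.exp s - 1))))
      ≤ (erdosRenyi n p).real {ω | HasLegalSystem (graphOf ω)} := by
  classical
  have := er_prob n p h0 h1
  let I : Finset (Sym2 (Fin n)) := univ.filter fun e => ¬ e.IsDiag
  let J : Fin n → Finset (Sym2 (Fin n)) := fun v => univ.image fun u => s(v, u)
  have hI : (I.card : ℝ) = n * (n - 1) / 2 := by
    have : I.card = n.choose 2 := by
      rw [← Fintype.card_subtype, Sym2.card_subtype_not_diag, Fintype.card_fin]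
    rw [this, Nat.cast_choose_two]
  have hJ : ∀ v, ((J v).card : ℝ) ≤ n := by
    intro v
    have : (J v).card ≤ n := card_image_le.trans (by simp)
    exact_mod_cast this
  let X : Finset (Sym2 (Fin n)) → (Sym2 (Fin n) → Bool) → ℝ :=
    fun I ω => ((I.filter fun e => ω e = false).card : ℝ)
  let A : Set (Sym2 (Fin n) → Bool) := {ω | X I ω ≤ 4 * t ^ 2}
  let B : Fin n → Set (Sym2 (Fin n) → Bool) := fun v => {ω | t ≤ X (J v) ω}
  have hA : (erdosRenyi n p).real A ≤
      Real.exp (a * (4 * t ^ 2) + (n * (n - 1) / 2) * ((1 - p) * (Real.exp (-a) - 1))) := by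
    refine (ProbabilityTheory.measure_le_le_exp_mul_mgf (4 * t ^ 2) (neg_nonpos.2 ha)
      Integrable.of_finite).trans ?_
    rw [Real.exp_add, neg_neg, ← hI]
    gcongr
    exact er_mgf_le n p h0 h1 I (-a)
  have hB : ∀ v, (erdosRenyi n p).real (B v) ≤
      Real.exp (-s * t + n * ((1 - p) * (Real.exp s - 1))) := by
    intro v
    refine (ProbabilityTheory.measure_ge_le_exp_mul_mgf t hs Integrable.of_finite).trans ?_
    rw [Real.exp_add]
    gcongr
    refine (er_mgf_le n p h0 h1 (J v) s).trans (Real.exp_le_exp.2 ?_)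
    refine mul_le_mul_of_nonneg_right (hJ v) (mul_nonneg (by linarith) ?_)
    have := Real.one_le_exp hs
    linarith
  have hsub : {ω | HasLegalSystem (graphOf ω)}ᶜ ⊆ A ∪ ⋃ v, B v := by
    intro ω hω
    by_contra hc
    apply hω
    simp only [A, B, Set.mem_union, Set.mem_iUnion, Set.mem_ofPred_eq, not_or, not_exists,
      not_le] at hc
    obtain ⟨hc1, hc2⟩ := hc
    have hdeg : ∀ v, ((univ.filter fun u => u ≠ v ∧ ω s(v, u) = false).card) ≤
        ((J v).filter fun e => ω e = false).card := by
      intro v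
      refine card_le_card_of_injOn (fun u => s(v, u)) ?_ ?_
      · intro u hu
        simp only [coe_filter, mem_univ, true_and, Set.mem_ofPred_eq] at hu
        simp [J, hu.2]
      · intro u _ w _ h
        exact Sym2.congr_right.1 h
    obtain ⟨v0, -, hv0⟩ := exists_max_image (univ : Finset (Fin n))
      (fun v => (univ.filter fun u => u ≠ v ∧ ω s(v, u) = false).card) ⟨⟨0, hn⟩, mem_univ _⟩
    refine legal_of_comb ω _ (fun v => hv0 v (mem_univ _)) ?_
    have h3 := hdeg v0
    have h4 := hc2 v0
    have h5 : ((univ.filter fun u => u ≠ v0 ∧ ω s(v0, u) = false).card : ℝ) ≤ X (J v0) ω := by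
      exact Nat.cast_le.2 h3
    set d := (univ.filter fun u => u ≠ v0 ∧ ω s(v0, u) = false).card
    have h6 : (d : ℝ) < t := h5.trans_lt h4
    have h7 : (d : ℝ) ^ 2 < t ^ 2 := by
      have : (0 : ℝ) ≤ d := Nat.cast_nonneg _
      nlinarith
    have h8 : (4 * d ^ 2 : ℝ) < X I ω := by linarith
    simp only [X, I, filter_filter] at h8
    exact_mod_cast h8
  have hm : MeasurableSet {ω : Sym2 (Fin n) → Bool | HasLegalSystem (graphOf ω)} :=
    (Set.toFinite _).measurableSet
  have h9 := probReal_compl_eq_one_sub (μ := erdosRenyi n p) hm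
  have h10 := (measureReal_mono (μ := erdosRenyi n p) hsub).trans (measureReal_union_le _ _)
  have h11 := (measureReal_iUnion_fintype_le (μ := erdosRenyi n p) B).trans
    (sum_le_sum fun v _ => hB v)
  simp only [sum_const, card_univ, Fintype.card_fin, nsmul_eq_mul] at h11
  linarith

lemma bad_bound2 (n : ℕ) (p : ℝ) (h0 : 0.99 ≤ p) (h1 : p < 1) (hn : 18 ≤ n)
    (hm : 9 ≤ (n : ℝ) ^ 2 * (1 - p)) :
    1 - (Real.exp (-0.0004 * ((n : ℝ) ^ 2 * (1 - p)))
      + 10 * (√((n : ℝ) ^ 2 * (1 - p)) * Real.exp (- (√((n : ℝ) ^ 2 * (1 - p)) / 30))))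
      ≤ (erdosRenyi n p).real {ω | HasLegalSystem (graphOf ω)} := by
  have hn' : (18 : ℝ) ≤ n := by exact_mod_cast hn
  set q := 1 - p with hq
  have hq0 : 0 < q := by linarith
  obtain ⟨r, hr0, hrq⟩ : ∃ r : ℝ, 0 < r ∧ q = r ^ 2 := ⟨√q, Real.sqrt_pos.2 hq0, (Real.sq_sqrt hq0.le).symm⟩
  have hr1 : r ≤ 1 / 10 := by
    have : q ≤ 0.01 := by linarith
    by_contra! h
    norm_num at this
    nlinarith
  set m := (n : ℝ) * r with hmdef
  have hmu : (n : ℝ) ^ 2 * q = m ^ 2 := by rw [hrq, hmdef]; ring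
  have hm0 : 0 < m := by positivity
  rw [hmu] at hm ⊢
  have hm3 : 3 ≤ m := by nlinarith
  rw [Real.sqrt_sq hm0.le]
  have h3r : 0 < 3 * r := by positivity
  set s := - Real.log (3 * r) with hs
  have hexps : Real.exp s = 1 / (3 * r) := by rw [hs, Real.exp_neg, Real.exp_log h3r, one_div]
  have hs1 : (11 / 10 : ℝ) ≤ s := by
    rw [← Real.exp_le_exp, hexps]
    have e1 : Real.exp (11 / 10) ≤ 10 / 3 := by
      have h1 : Real.exp (11 / 10) = Real.exp 1 * Real.exp (1 / 10) := by
        rw [← Real.exp_add]; norm_num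
      have h2 := Real.exp_one_lt_d9
      have h3 : Real.exp (1 / 10) ≤ 1 / (1 - 1 / 10) := Real.exp_bound_div_one_sub_of_interval' (by norm_num) (by norm_num) |>.le
      rw [h1]
      have := Real.exp_pos (1 / 10)
      norm_num at h3 h2
      nlinarith
    refine e1.trans ?_
    rw [le_div_iff₀ h3r]
    linarith
  have hb := bad_bound n p (by linarith) h1.le (m / 3) s (1 / 10) (by linarith) (by norm_num) (by omega)
  refine le_trans ?_ hb
  have ea : Real.exp (-(1 / 10)) ≤ 0.905 := by
    rw [Real.exp_neg]
    have := Real.quadratic_le_exp_of_nonneg (x := 1 / 10) (by norm_num)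
    rw [inv_le_comm₀ (Real.exp_pos _) (by norm_num)]
    refine le_trans ?_ this
    norm_num
  have b1 : Real.exp (1 / 10 * (4 * (m / 3) ^ 2) + (n * (n - 1) / 2) * ((1 - p) * (Real.exp (-(1 / 10)) - 1)))
      ≤ Real.exp (-0.0004 * m ^ 2) := by
    apply Real.exp_le_exp.2
    rw [← hq]
    have c1 : (n : ℝ) * (n - 1) / 2 * q ≥ 17 / 36 * m ^ 2 := by
      rw [← hmu]
      have : (n : ℝ) * (n - 1) / 2 ≥ 17 / 36 * n ^ 2 := by nlinarith
      nlinarith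
    have c2 : (n : ℝ) * (n - 1) / 2 * q * (1 - Real.exp (-(1 / 10))) ≥ 17 / 36 * m ^ 2 * 0.095 := by
      apply mul_le_mul c1 (by linarith) (by norm_num) (le_trans (by positivity) c1)
    have c3 : 0 < m ^ 2 := by positivity
    norm_num at c2 ⊢
    nlinarith
  have b2 : n * Real.exp (-s * (m / 3) + n * ((1 - p) * (Real.exp s - 1))) ≤
      10 * (m * Real.exp (- (m / 30))) := by
    have d1 : n * ((1 - p) * (Real.exp s - 1)) ≤ m / 3 := by
      rw [← hq, hexps, hrq]
      have : (n : ℝ) * (r ^ 2 * (1 / (3 * r) - 1)) = m / 3 - n * r ^ 2 := by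
        rw [hmdef]; field_simp
      rw [this]
      have : 0 ≤ (n : ℝ) * r ^ 2 := by positivity
      linarith
    have d2 : -s * (m / 3) + n * ((1 - p) * (Real.exp s - 1)) ≤ -s + (11 / 10 + -(m / 30)) := by
      nlinarith
    have d3 : Real.exp (11 / 10) ≤ 10 / 3 := by
      have h1 : Real.exp (11 / 10) = Real.exp 1 * Real.exp (1 / 10) := by
        rw [← Real.exp_add]; norm_num
      have h2 := Real.exp_one_lt_d9
      have h3 : Real.exp (1 / 10) ≤ 1 / (1 - 1 / 10) := Real.exp_bound_div_one_sub_of_interval' (by norm_num) (by norm_num) |>.le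
      rw [h1]
      have := Real.exp_pos (1 / 10)
      norm_num at h3 h2
      nlinarith
    have d4 : Real.exp (-s) = 3 * r := by rw [hs, neg_neg, Real.exp_log h3r]
    calc n * Real.exp (-s * (m / 3) + n * ((1 - p) * (Real.exp s - 1)))
        ≤ n * Real.exp (-s + (11 / 10 + -(m / 30))) := by gcongr
      _ = n * (3 * r * (Real.exp (11 / 10) * Real.exp (-(m / 30)))) := by
          rw [Real.exp_add, Real.exp_add, d4]
      _ ≤ n * (3 * r * (10 / 3 * Real.exp (-(m / 30)))) := by gcongr
      _ = 10 * (m * Real.exp (- (m / 30))) := by rw [hmdef]; ring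
  linarith

theorem aas_very_dense_gnp_has_legal_system (p : ℕ → ℝ)
    (hp : ∀ n : ℕ, 0.99 ≤ p n ∧ p n < 1)
    (hp2 : Tendsto (fun n : ℕ => (n : ℝ) ^ 2 * (1 - p n)) atTop atTop) :
    Tendsto (fun n : ℕ => erdosRenyi n (p n) {ω | HasLegalSystem (graphOf ω)})
      atTop (nhds 1) := by
  have hpr : ∀ n, IsProbabilityMeasure (erdosRenyi n (p n)) := fun n =>
    er_prob n (p n) (le_trans (by norm_num) (hp n).1) (hp n).2.le
  have hreal : Tendsto (fun n : ℕ => (erdosRenyi n (p n)).real {ω | HasLegalSystem (graphOf ω)})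
      atTop (nhds 1) := by
    have t1 : Tendsto (fun x : ℝ => Real.exp (-0.0004 * x)) atTop (nhds 0) :=
      Real.tendsto_exp_atBot.comp (tendsto_id.const_mul_atTop_of_neg (by norm_num))
    have t2 : Tendsto (fun x : ℝ => x * Real.exp (-(x / 30))) atTop (nhds 0) := by
      have h := (Real.tendsto_pow_mul_exp_neg_atTop_nhds_zero 1).comp
        (tendsto_id.atTop_div_const (show (0 : ℝ) < 30 by norm_num))
      have h' := h.const_mul 30
      rw [mul_zero] at h'
      refine h'.congr fun x => ?_
      simp only [Function.comp, id, pow_one]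
      ring
    have t3 := t1.comp hp2
    have t4 := t2.comp (Real.tendsto_sqrt_atTop.comp hp2)
    have t5 := (t3.add (t4.const_mul 10)).const_sub 1
    rw [mul_zero, add_zero, sub_zero] at t5
    refine tendsto_of_tendsto_of_tendsto_of_le_of_le' t5 tendsto_const_nhds ?_ ?_
    · filter_upwards [eventually_ge_atTop 18, hp2.eventually_ge_atTop 9] with n hn hm
      have := bad_bound2 n (p n) (hp n).1 (hp n).2 hn hm
      simpa only [Function.comp] using this
    · exact Eventually.of_forall fun n => by
        have := hpr n
        exact measureReal_le_one
  have h := ENNReal.tendsto_ofReal hreal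
  rw [ENNReal.ofReal_one] at h
  refine h.congr fun n => ?_
  have := hpr n
  exact ofReal_measureReal
end
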